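/- arXiv:1806.04565 — 2 statements merged into one kernel-verified Lean document; each statement's English description precedes it below -/
import Mathlib

section
/- Let r, t ≥ 3, s ≤ −3 and u ≤ −3 be odd integers and let n ≥ 1. Then every point (a,b,c,d) ∈ nP ∩ ℤ⁴ with T_{a,b,c,d} ≠ 0 that maximizes the v-degree δ(a,b,c,d) over all such points satisfies b = a + c and d = 0 (with 0 ≤ a, c and a + c ≤ n). -/
/-!
Common definitions for formalizing "Colored Jones polynomials without tails"
(Lee--van der Veen).  We work in the field `RatFunc ℚ` of rational functions
in one variable `V` over `ℚ`.
-/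

open Polynomial

noncomputable section

namespace CJP

/-- The variable `v` of the field `ℚ(v)`. -/
noncomputable def V : RatFunc ℚ := RatFunc.X

/-- The quantum integer `[k] = ∑_{j=0}^{k-1} v^(2(k-1)-4j)`, so that
`(v^2 - v^(-2)) * [k] = v^(2k) - v^(-2k)`; it is `0` for `k ≤ 0`. -/
noncomputable def qint (k : ℤ) : RatFunc ℚ :=
  ∑ j ∈ Finset.range k.toNat, V ^ (2 * (k - 1) - 4 * (j : ℤ))

/-- The quantum factorial `[k]! = [1][2]⋯[k]` for `k ≥ 0`, and `0` for `k < 0`. -/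
noncomputable def qfact (k : ℤ) : RatFunc ℚ :=
  if k < 0 then 0 else ∏ j ∈ Finset.range k.toNat, qint ((j : ℤ) + 1)

/-- `O^k = (-1)^k [k+1]`. -/
noncomputable def qO (k : ℤ) : RatFunc ℚ := (-1 : RatFunc ℚ) ^ k * qint (k + 1)

/-- The two-part quantum multinomial (quantum binomial) `[n; k, n-k]`. -/
noncomputable def qbinom (n k : ℤ) : RatFunc ℚ := qfact n / (qfact k * qfact (n - k))

/-- `θ(a,b,c) = O^((a+b+c)/2) ⬝ [(a+b+c)/2; (-a+b+c)/2, (a-b+c)/2, (a+b-c)/2]`. -/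
noncomputable def qtheta (a b c : ℤ) : RatFunc ℚ :=
  qO ((a + b + c) / 2) * (qfact ((a + b + c) / 2) /
    (qfact ((-a + b + c) / 2) * qfact ((a - b + c) / 2) * qfact ((a + b - c) / 2)))

/-- The normalized 6j-symbol
`Δ(a,b,c,α,β,γ) = ∑_z (O^z / O^((a+b+c)/2)) [z; (a+b+c)/2, z-(a+b+c)/2] ⋯`.
Only finitely many `z` give a nonzero summand, so the `finsum` is well defined. -/
noncomputable def qdelta (a b c α β γ : ℤ) : RatFunc ℚ :=
  ∑ᶠ z : ℤ, (qO z / qO ((a + b + c) / 2)) * qbinom z ((a + b + c) / 2) *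
    qbinom ((-a + b + c) / 2) (z - (a + β + γ) / 2) *
    qbinom ((a - b + c) / 2) (z - (α + b + γ) / 2) *
    qbinom ((a + b - c) / 2) (z - (α + β + c) / 2)

/-- The framing factor `f(a) = i^(-a) v^(-a(a+2)/2)`, written for even `a`
(where it equals `(-1)^(a/2) v^(-a(a+2)/2)`, an element of `ℤ[v,v⁻¹]`). -/
noncomputable def qf (a : ℤ) : RatFunc ℚ :=
  (-1 : RatFunc ℚ) ^ (a / 2) * V ^ (-(a * (a + 2)) / 2)

/-- `f(a)^e = i^(-a e) v^(-a(a+2)e/2)` for `a*e` even, where it equals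
`(-1)^(a e / 2) v^(-a(a+2)e/2)`. -/
noncomputable def qfpow (a e : ℤ) : RatFunc ℚ :=
  (-1 : RatFunc ℚ) ^ (a * e / 2) * V ^ (-(a * (a + 2) * e) / 2)

/-- `x ∈ ℚ(v)` is a Laurent polynomial with integer coefficients: for some `m`,
`x * v^m` is (the image in `ℚ(v)` of) a polynomial with integer coefficients. -/
def IsIntLaurent (x : RatFunc ℚ) : Prop :=
  ∃ (p : Polynomial ℤ) (m : ℕ),
    x * V ^ m = algebraMap (Polynomial ℚ) (RatFunc ℚ) (p.map (Int.castRingHom ℚ))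

/-- The leading coefficient of a rational function : the ratio of the leading
coefficients of its numerator and denominator. -/
noncomputable def leadC (x : RatFunc ℚ) : ℚ := x.num.leadingCoeff / x.denom.leadingCoeff

/-- Admissibility of a triple of nonnegative integers. -/
def Admissible (a b c : ℤ) : Prop := 2 ∣ (a + b + c) ∧ |a - b| ≤ c ∧ c ≤ a + b

/-- Membership of an integer lattice point in the polytope `nP`, where
`P = {(a,b,c,d) ∈ [0,1]⁴ : |a-b| ≤ c ≤ a+b}`. -/
def inP (n a b c d : ℤ) : Prop :=
  0 ≤ a ∧ a ≤ n ∧ 0 ≤ b ∧ b ≤ n ∧ 0 ≤ c ∧ c ≤ n ∧ 0 ≤ d ∧ d ≤ n ∧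
    |a - b| ≤ c ∧ c ≤ a + b

/-- The summand `T_{a,b,c,d}` of the state sum for the colored Jones polynomial
`J_{C(r,s,t,u),n+1}`. -/
noncomputable def T (r s t u n a b c d : ℤ) : RatFunc ℚ :=
  (qdelta (2*a) (2*b) (2*c) n n n) ^ 2 * qdelta (2*b) n n (2*d) n n *
    qO (2*a) * qO (2*b) * qO (2*c) * qO (2*d) *
    qf (2*a) ^ r * qf (2*b) ^ s * qf (2*c) ^ t * qf (2*d) ^ (-u) *
    qtheta (2*a) (2*b) (2*c) /
    (qtheta (2*a) n n * qtheta (2*b) n n * qtheta (2*c) n n * qtheta (2*d) n n)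

/-- The state sum `J(r,s,t,u; n+1)`, i.e. the `(n+1)`-colored Jones polynomial of the
`0`-framed Montesinos knot `C(r,s,t,u)`:
`f(n)^(-2(r-s+t-u)-2r-2s-2t+2u) ⬝ ∑_{(a,b,c,d) ∈ nP ∩ ℤ⁴} T_{a,b,c,d}`. -/
noncomputable def J (r s t u n : ℤ) : RatFunc ℚ :=
  qfpow n (-2*(r - s + t - u) - 2*r - 2*s - 2*t + 2*u) *
    ∑ a ∈ Finset.Icc 0 n, ∑ b ∈ Finset.Icc 0 n, ∑ c ∈ Finset.Icc 0 n,
      ∑ d ∈ Finset.Icc 0 n,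
        if |a - b| ≤ c ∧ c ≤ a + b then T r s t u n a b c d else 0

end CJP

namespace CJP

/-- `x` is nonzero of `v`-degree `k`. -/
def HasDeg (x : RatFunc ℚ) (k : ℤ) : Prop := x ≠ 0 ∧ x.intDegree = k

/-- `x` is zero or of `v`-degree smaller than `k`. -/
def DegLT (x : RatFunc ℚ) (k : ℤ) : Prop := x = 0 ∨ x.intDegree < k

lemma HasDeg.congr {x : RatFunc ℚ} {k l : ℤ} (hx : HasDeg x k) (h : k = l) : HasDeg x l :=
  h ▸ hx

lemma hasDeg_one : HasDeg 1 0 := ⟨one_ne_zero, RatFunc.intDegree_one⟩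

lemma HasDeg.mul {x y : RatFunc ℚ} {k l : ℤ} (hx : HasDeg x k) (hy : HasDeg y l) :
    HasDeg (x * y) (k + l) :=
  ⟨mul_ne_zero hx.1 hy.1, by rw [RatFunc.intDegree_mul hx.1 hy.1, hx.2, hy.2]⟩

lemma HasDeg.inv {x : RatFunc ℚ} {k : ℤ} (hx : HasDeg x k) : HasDeg x⁻¹ (-k) :=
  ⟨inv_ne_zero hx.1, by rw [RatFunc.intDegree_inv, hx.2]⟩

lemma HasDeg.div {x y : RatFunc ℚ} {k l : ℤ} (hx : HasDeg x k) (hy : HasDeg y l) :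
    HasDeg (x / y) (k - l) := by
  rw [div_eq_mul_inv, sub_eq_add_neg]
  exact hx.mul hy.inv

lemma HasDeg.pow {x : RatFunc ℚ} {k : ℤ} (hx : HasDeg x k) (m : ℕ) :
    HasDeg (x ^ m) (m * k) := by
  induction m with
  | zero => simpa using hasDeg_one
  | succ m ih =>
    rw [pow_succ]
    exact (ih.mul hx).congr (by push_cast; ring)

lemma HasDeg.zpow {x : RatFunc ℚ} {k : ℤ} (hx : HasDeg x k) (m : ℤ) :
    HasDeg (x ^ m) (m * k) := by
  obtain ⟨j, rfl | rfl⟩ := m.eq_nat_or_neg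
  · rw [zpow_natCast]
    exact hx.pow j
  · rw [zpow_neg, zpow_natCast]
    exact (hx.pow j).inv.congr (by ring)

lemma hasDeg_neg_one : HasDeg (-1) 0 :=
  ⟨by simp, by rw [RatFunc.intDegree_neg, RatFunc.intDegree_one]⟩

lemma hasDeg_V : HasDeg V 1 := ⟨RatFunc.X_ne_zero, RatFunc.intDegree_X⟩

lemma DegLT.add {x y : RatFunc ℚ} {k : ℤ} (hx : DegLT x k) (hy : DegLT y k) :
    DegLT (x + y) k := by
  rcases hx with rfl | hx
  · simpa using hy
  rcases hy with rfl | hy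
  · right
    simpa using hx
  by_cases hxy : x + y = 0
  · exact Or.inl hxy
  by_cases hy0 : y = 0
  · right
    simpa [hy0] using hx
  · exact Or.inr ((RatFunc.intDegree_add_le hy0 hxy).trans_lt (max_lt hx hy))

lemma HasDeg.add {x y : RatFunc ℚ} {k : ℤ} (hx : HasDeg x k) (hy : DegLT y k) :
    HasDeg (x + y) k := by
  obtain ⟨hx0, rfl⟩ := hx
  by_cases hy0 : y = 0
  · subst hy0
    simpa using ⟨hx0, rfl⟩
  have hlt := hy.resolve_left hy0
  have hxy : x + y ≠ 0 := by
    intro h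
    rw [eq_neg_of_add_eq_zero_right h, RatFunc.intDegree_neg] at hlt
    exact lt_irrefl _ hlt
  have h1 := RatFunc.intDegree_add_le hy0 hxy
  have h2 := RatFunc.intDegree_add_le (x := x + y) (y := -y) (neg_ne_zero.2 hy0) (by simpa)
  rw [add_neg_cancel_right, RatFunc.intDegree_neg] at h2
  refine ⟨hxy, le_antisymm (by rwa [max_eq_left hlt.le] at h1) ?_⟩
  exact (le_max_iff.1 h2).resolve_right hlt.not_ge

lemma degLT_sum {ι : Type*} (s : Finset ι) (f : ι → RatFunc ℚ) (k : ℤ)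
    (h : ∀ j ∈ s, DegLT (f j) k) : DegLT (∑ j ∈ s, f j) k :=
  Finset.sum_induction f (DegLT · k) (fun _ _ => DegLT.add) (Or.inl rfl) h

lemma hasDeg_sum {ι : Type*} [DecidableEq ι] (s : Finset ι) (f : ι → RatFunc ℚ) (k : ℤ) {i : ι}
    (hi : i ∈ s) (hfi : HasDeg (f i) k) (h : ∀ j ∈ s, j ≠ i → DegLT (f j) k) :
    HasDeg (∑ j ∈ s, f j) k := by
  rw [← Finset.add_sum_erase s f hi]
  exact hfi.add (degLT_sum _ _ _ fun j hj =>
    h j (Finset.mem_of_mem_erase hj) (Finset.ne_of_mem_erase hj))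

/-- A sum over `ℤ` whose terms vanish outside `[l, m]`, and in which the term at `m` has the
strictly largest degree `k`, has degree `k`. -/
lemma hasDeg_finsum (f : ℤ → RatFunc ℚ) (l m k : ℤ) (hlm : l ≤ m) (hm : HasDeg (f m) k)
    (hlow : ∀ z, z < l → f z = 0) (hhigh : ∀ z, m < z → f z = 0)
    (hlt : ∀ z, l ≤ z → z < m → DegLT (f z) k) : HasDeg (∑ᶠ z, f z) k := by
  have hsupp : Function.support f ⊆ ↑(Finset.Icc l m) := by
    intro z hz
    rw [Finset.coe_Icc]
    by_contra hzI
    rw [Set.mem_Icc, not_and_or, not_le, not_le] at hzI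
    exact hz (hzI.elim (hlow z) (hhigh z))
  rw [finsum_eq_sum_of_support_subset f hsupp]
  refine hasDeg_sum _ _ _ (Finset.right_mem_Icc.2 hlm) hm fun z hz hzm => ?_
  rw [Finset.mem_Icc] at hz
  exact hlt z hz.1 (lt_of_le_of_ne hz.2 hzm)

lemma hasDeg_V_zpow (k : ℤ) : HasDeg (V ^ k) k := (hasDeg_V.zpow k).congr (mul_one k)

lemma hasDeg_qint {k : ℤ} (hk : 1 ≤ k) : HasDeg (qint k) (2 * (k - 1)) := by
  refine hasDeg_sum _ _ _ (i := 0) (Finset.mem_range.2 (by omega)) ?_ fun j _ hj => ?_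
  · exact (hasDeg_V_zpow _).congr (by simp)
  · right
    rw [(hasDeg_V_zpow _).2]
    omega

lemma hasDeg_qfact {k : ℤ} (hk : 0 ≤ k) : HasDeg (qfact k) (k * (k - 1)) := by
  lift k to ℕ using hk
  have h : ∀ m : ℕ, HasDeg (∏ j ∈ Finset.range m, qint ((j : ℤ) + 1)) ((m : ℤ) * (m - 1)) := by
    intro m
    induction m with
    | zero => simpa using hasDeg_one
    | succ m ih =>
      rw [Finset.prod_range_succ]
      exact (ih.mul (hasDeg_qint (by omega))).congr (by push_cast; ring)
  rw [qfact, if_neg (by omega), Int.toNat_natCast]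
  exact h k

lemma qfact_of_neg {k : ℤ} (hk : k < 0) : qfact k = 0 := if_pos hk

lemma hasDeg_qO {k : ℤ} (hk : 0 ≤ k) : HasDeg (qO k) (2 * k) :=
  ((hasDeg_neg_one.zpow k).mul (hasDeg_qint (by omega))).congr (by ring)

lemma hasDeg_qbinom {n k : ℤ} (hk : 0 ≤ k) (hkn : k ≤ n) :
    HasDeg (qbinom n k) (2 * (k * (n - k))) :=
  ((hasDeg_qfact (hk.trans hkn)).div
    ((hasDeg_qfact hk).mul (hasDeg_qfact (sub_nonneg.2 hkn)))).congr (by ring)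

lemma qbinom_of_neg {n k : ℤ} (hk : k < 0) : qbinom n k = 0 := by
  simp [qbinom, qfact_of_neg hk]

lemma qbinom_of_lt {n k : ℤ} (hk : n < k) : qbinom n k = 0 := by
  simp [qbinom, qfact_of_neg (sub_neg.2 hk)]

lemma hasDeg_qf (a : ℤ) : HasDeg (qf (2 * a)) (-(2 * a * (a + 1))) := by
  have h : -(2 * a * (2 * a + 2)) / 2 = -(2 * a * (a + 1)) := by
    rw [show -(2 * a * (2 * a + 2)) = 2 * -(2 * a * (a + 1)) by ring]
    omega
  rw [qf, h]
  exact ((hasDeg_neg_one.zpow _).mul (hasDeg_V_zpow _)).congr (by ring)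

lemma hasDeg_qtheta {a b c x y z : ℤ} (ha : a = y + z) (hb : b = x + z) (hc : c = x + y)
    (hx : 0 ≤ x) (hy : 0 ≤ y) (hz : 0 ≤ z) :
    HasDeg (qtheta a b c) (2 * (x + y + z) + 2 * (x * y + y * z + z * x)) := by
  subst ha hb hc
  rw [qtheta, show (y + z + (x + z) + (x + y)) / 2 = x + y + z by omega,
    show (-(y + z) + (x + z) + (x + y)) / 2 = x by omega,
    show (y + z - (x + z) + (x + y)) / 2 = y by omega,
    show (y + z + (x + z) - (x + y)) / 2 = z by omega]
  exact ((hasDeg_qO (by omega)).mul ((hasDeg_qfact (by omega)).div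
    (((hasDeg_qfact hx).mul (hasDeg_qfact hy)).mul (hasDeg_qfact hz)))).congr (by ring)

lemma hasDeg_qtheta_twist {n a : ℤ} (ha : 0 ≤ a) (han : a ≤ n) :
    HasDeg (qtheta (2 * a) n n) (2 * (n + a) + 4 * a * n - 2 * a ^ 2) :=
  (hasDeg_qtheta (x := n - a) (y := a) (z := a) (by ring) (by ring) (by ring)
    (by omega) ha ha).congr (by ring)

/-- The `v`-degree of a summand of `qdelta`, in terms of `S = (a+b+c)/2`, the parameters
`p, q, w` that are the upper arguments of the last three binomials, and the shifts `i, j, k`. -/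
def termDeg (S p q w i j k z : ℤ) : ℤ :=
  2 * z - 2 * S + 2 * (S * (z - S)) + 2 * ((z - i) * (p - (z - i))) +
    2 * ((z - j) * (q - (z - j))) + 2 * ((z - k) * (w - (z - k)))

/-- The degree of a sum as in `qdelta` is attained at the largest admissible `z`,
provided that the degrees increase up to there. -/
lemma hasDeg_finsum_term {S p q w i j k l m : ℤ} (hS : 0 ≤ S) (hlm : l ≤ m)
    (hl : ∀ z, l ≤ z ↔ S ≤ z ∧ i ≤ z ∧ j ≤ z ∧ k ≤ z)
    (hm : ∀ z, z ≤ m ↔ z ≤ p + i ∧ z ≤ q + j ∧ z ≤ w + k)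
    (hinc : 6 * m ≤ 3 + S + p + q + w + 2 * (i + j + k)) :
    HasDeg (∑ᶠ z : ℤ, (qO z / qO S) * qbinom z S * qbinom p (z - i) * qbinom q (z - j) *
      qbinom w (z - k)) (termDeg S p q w i j k m) := by
  have hterm : ∀ z, l ≤ z → z ≤ m → HasDeg ((qO z / qO S) * qbinom z S * qbinom p (z - i) *
      qbinom q (z - j) * qbinom w (z - k)) (termDeg S p q w i j k z) := by
    intro z hlz hzm
    obtain ⟨h1, h2, h3, h4⟩ := (hl z).1 hlz
    obtain ⟨h5, h6, h7⟩ := (hm z).1 hzm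
    exact ((((((hasDeg_qO (hS.trans h1)).div (hasDeg_qO hS)).mul (hasDeg_qbinom hS h1)).mul
      (hasDeg_qbinom (by omega) (by omega))).mul (hasDeg_qbinom (by omega) (by omega))).mul
      (hasDeg_qbinom (by omega) (by omega))).congr (by unfold termDeg; ring)
  refine hasDeg_finsum _ l m _ hlm (hterm m hlm le_rfl) ?_ ?_ ?_
  · intro z hz
    have h : ¬ (S ≤ z ∧ i ≤ z ∧ j ≤ z ∧ k ≤ z) := fun h => hz.not_ge ((hl z).2 h)
    by_cases h1 : S ≤ z
    · by_cases h2 : i ≤ z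
      · by_cases h3 : j ≤ z
        · rw [qbinom_of_neg (show z - k < 0 by omega)]
          ring
        · rw [qbinom_of_neg (show z - j < 0 by omega)]
          ring
      · rw [qbinom_of_neg (show z - i < 0 by omega)]
        ring
    · rw [qbinom_of_lt (show z < S by omega)]
      ring
  · intro z hz
    have h : ¬ (z ≤ p + i ∧ z ≤ q + j ∧ z ≤ w + k) := fun h => hz.not_ge ((hm z).2 h)
    by_cases h1 : z ≤ p + i
    · by_cases h2 : z ≤ q + j
      · rw [qbinom_of_lt (show w < z - k by omega)]
        ring
      · rw [qbinom_of_lt (show q < z - j by omega)]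
        ring
    · rw [qbinom_of_lt (show p < z - i by omega)]
      ring
  · intro z hlz hzm
    right
    rw [(hterm z hlz hzm.le).2]
    have h : 0 < (m - z) * (2 + 2 * S + 2 * (p + q + w) + 4 * (i + j + k) - 6 * (m + z)) :=
      mul_pos (by omega) (by omega)
    unfold termDeg
    linarith

/-- The `v`-degree of `Δ(2a,2b,2c,n,n,n)`, where `m` is the largest summation index. -/
lemma hasDeg_qdelta_vertex {n a b c m : ℤ} (hP : inP n a b c 0)
    (hab : m ≤ n + a + b) (hbc : m ≤ n + b + c) (hac : m ≤ n + a + c)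
    (hm : m = n + a + b ∨ m = n + b + c ∨ m = n + a + c) :
    HasDeg (qdelta (2 * a) (2 * b) (2 * c) n n n)
      (termDeg (a + b + c) (-a + b + c) (a - b + c) (a + b - c) (a + n) (b + n) (c + n) m) := by
  obtain ⟨ha, han, hb, hbn, hc, hcn, -, -, h1, h2⟩ := hP
  rw [abs_le] at h1
  rw [qdelta, show (2 * a + 2 * b + 2 * c) / 2 = a + b + c by omega,
    show (-(2 * a) + 2 * b + 2 * c) / 2 = -a + b + c by omega,
    show (2 * a - 2 * b + 2 * c) / 2 = a - b + c by omega,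
    show (2 * a + 2 * b - 2 * c) / 2 = a + b - c by omega,
    show (2 * a + n + n) / 2 = a + n by omega,
    show (n + 2 * b + n) / 2 = b + n by omega,
    show (n + n + 2 * c) / 2 = c + n by omega]
  refine hasDeg_finsum_term (l := max (a + b + c) (max (a + n) (max (b + n) (c + n))))
    (by omega) (by omega) (fun z => by omega) (fun z => by omega) (by omega)

/-- The `v`-degree of `Δ(2b,n,n,2d,n,n)`, where `m` is the largest summation index. -/
lemma hasDeg_qdelta_edge {n b d m : ℤ} (hb : 0 ≤ b) (hbn : b ≤ n) (hd : 0 ≤ d) (hdn : d ≤ n)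
    (hm1 : m ≤ 2 * n) (hm2 : m ≤ n + b + d) (hm : m = 2 * n ∨ m = n + b + d) :
    HasDeg (qdelta (2 * b) n n (2 * d) n n)
      (termDeg (b + n) (n - b) b b (b + n) (d + n) (d + n) m) := by
  rw [qdelta, show (2 * b + n + n) / 2 = b + n by omega,
    show (-(2 * b) + n + n) / 2 = n - b by omega,
    show (2 * b - n + n) / 2 = b by omega,
    show (2 * b + n - n) / 2 = b by omega,
    show (2 * d + n + n) / 2 = d + n by omega]
  exact hasDeg_finsum_term (l := max (b + n) (d + n))
    (by omega) (by omega) (fun z => by omega) (fun z => by omega) (by omega)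

/-- The `v`-degree of `T`, where `m` and `m'` are the largest summation indices of its
two `Δ` factors. -/
def summandDeg (r s t u n a b c d m m' : ℤ) : ℤ :=
  2 * termDeg (a + b + c) (-a + b + c) (a - b + c) (a + b - c) (a + n) (b + n) (c + n) m +
    termDeg (b + n) (n - b) b b (b + n) (d + n) (d + n) m' +
    4 * (a + b + c + d) - r * (2 * a * (a + 1)) - s * (2 * b * (b + 1)) -
    t * (2 * c * (c + 1)) + u * (2 * d * (d + 1)) + 2 * (a + b + c) +
    (4 * (a * b + b * c + a * c) - 2 * (a ^ 2 + b ^ 2 + c ^ 2)) -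
    ((2 * (n + a) + 4 * a * n - 2 * a ^ 2) + (2 * (n + b) + 4 * b * n - 2 * b ^ 2) +
      (2 * (n + c) + 4 * c * n - 2 * c ^ 2) + (2 * (n + d) + 4 * d * n - 2 * d ^ 2))

lemma hasDeg_T {r s t u n a b c d m m' : ℤ} (hP : inP n a b c d)
    (hab : m ≤ n + a + b) (hbc : m ≤ n + b + c) (hac : m ≤ n + a + c)
    (hm : m = n + a + b ∨ m = n + b + c ∨ m = n + a + c)
    (hm1 : m' ≤ 2 * n) (hm2 : m' ≤ n + b + d) (hm' : m' = 2 * n ∨ m' = n + b + d) :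
    HasDeg (T r s t u n a b c d) (summandDeg r s t u n a b c d m m') := by
  have hP' := hP
  obtain ⟨ha, han, hb, hbn, hc, hcn, hd, hdn, h1, h2⟩ := hP'
  have hvertex := hasDeg_qdelta_vertex ⟨ha, han, hb, hbn, hc, hcn, le_rfl, by omega, h1, h2⟩
    hab hbc hac hm
  have hedge := hasDeg_qdelta_edge hb hbn hd hdn hm1 hm2 hm'
  rw [abs_le] at h1
  have htheta : HasDeg (qtheta (2 * a) (2 * b) (2 * c)) _ :=
    hasDeg_qtheta (x := -a + b + c) (y := a - b + c) (z := a + b - c)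
      (by ring) (by ring) (by ring) (by omega) (by omega) (by omega)
  have hnum := ((((((((((hvertex.pow 2).mul hedge).mul (hasDeg_qO (k := 2 * a) (by omega))).mul
    (hasDeg_qO (k := 2 * b) (by omega))).mul (hasDeg_qO (k := 2 * c) (by omega))).mul
    (hasDeg_qO (k := 2 * d) (by omega))).mul ((hasDeg_qf a).zpow r)).mul
    ((hasDeg_qf b).zpow s)).mul ((hasDeg_qf c).zpow t)).mul ((hasDeg_qf d).zpow (-u))).mul htheta
  have hden := (((hasDeg_qtheta_twist ha han).mul (hasDeg_qtheta_twist hb hbn)).mul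
    (hasDeg_qtheta_twist hc hcn)).mul (hasDeg_qtheta_twist hd hdn)
  exact (hnum.div hden).congr (by unfold summandDeg; push_cast; ring)

/-- Replacing `d > 0` by `d = 0` increases the degree. -/
lemma summandDeg_lt_zero {r s t u n a b c d m m' : ℤ} (hu : u ≤ -3) (hd : 0 < d)
    (hm1 : m' ≤ 2 * n) (hm2 : m' ≤ n + b + d)
    (hm' : m' = 2 * n ∨ m' = n + b + d) :
    summandDeg r s t u n a b c d m m' < summandDeg r s t u n a b c 0 m (n + b) := by
  have hu' : 0 ≤ (-3 - u) * (d * (d + 1)) := mul_nonneg (by omega) (by positivity)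
  unfold summandDeg termDeg
  rcases hm' with rfl | rfl
  · have h : 0 ≤ d * (d - (n - b)) := mul_nonneg hd.le (by omega)
    nlinarith [sq_nonneg (n - b), mul_pos hd hd]
  · nlinarith [mul_pos hd hd]

/-- In the face `d = 0`, increasing `b` increases the degree if `b` is the largest of
`a, b, c`. -/
lemma summandDeg_lt_succ {r s t u n a b c m : ℤ} (hs : s ≤ -3) (ha : 0 ≤ a) (hb : 0 ≤ b)
    (hc : 0 ≤ c) (hm : m = n + a + c) :
    summandDeg r s t u n a b c 0 m (n + b) <
      summandDeg r s t u n a (b + 1) c 0 m (n + (b + 1)) := by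
  subst hm
  have hs' : 0 ≤ (-3 - s) * (b + 1) := mul_nonneg (by omega) (by omega)
  unfold summandDeg termDeg
  linarith

/-- In the face `d = 0`, increasing `b` increases the degree if `a` is the largest of
`a, b, c`. -/
lemma summandDeg_lt_succ_left {r s t u n a b c m : ℤ} (hs : s ≤ -3) (hb : 0 ≤ b)
    (hca : c ≤ a) (hm : m = n + b + c) :
    summandDeg r s t u n a b c 0 m (n + b) <
      summandDeg r s t u n a (b + 1) c 0 (m + 1) (n + (b + 1)) := by
  subst hm
  have hs' : 0 ≤ (-3 - s) * (b + 1) := mul_nonneg (by omega) (by omega)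
  unfold summandDeg termDeg
  linarith

/-- In the face `d = 0`, increasing `b` increases the degree if `c` is the largest of
`a, b, c`. -/
lemma summandDeg_lt_succ_right {r s t u n a b c m : ℤ} (hs : s ≤ -3) (hb : 0 ≤ b)
    (hac : a ≤ c) (hm : m = n + a + b) :
    summandDeg r s t u n a b c 0 m (n + b) <
      summandDeg r s t u n a (b + 1) c 0 (m + 1) (n + (b + 1)) := by
  subst hm
  have hs' : 0 ≤ (-3 - s) * (b + 1) := mul_nonneg (by omega) (by omega)
  unfold summandDeg termDeg
  linarith

/-- In the face `d = 0`, for `b = n < a + c`, decreasing `a` increases the degree. -/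
lemma summandDeg_lt_pred {r s t u n a c : ℤ} (hr : 3 ≤ r) (ha : 0 < a) (hac : n < a + c) :
    summandDeg r s t u n a n c 0 (n + a + c) (n + n) <
      summandDeg r s t u n (a - 1) n c 0 (n + (a - 1) + c) (n + n) := by
  have hr' : 0 ≤ (r - 3) * a := mul_nonneg (by omega) ha.le
  unfold summandDeg termDeg
  linarith

end CJP

open CJP in
/-- For odd integers `r,t ≥ 3`, `s ≤ -3`, `u ≤ -3` and `n ≥ 1`,
every point of `nP ∩ ℤ⁴` with nonzero summand maximizing the `v`-degree `δ`
satisfies `b = a + c` and `d = 0` (with `0 ≤ a, c` and `a + c ≤ n`). -/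
theorem maximizers_on_faces (r s t u n : ℤ)
    (hrodd : Odd r) (hsodd : Odd s) (htodd : Odd t) (huodd : Odd u)
    (hr : 3 ≤ r) (ht : 3 ≤ t) (hs : s ≤ -3) (hu : u ≤ -3) (hn : 1 ≤ n)
    (a b c d : ℤ) (hP : inP n a b c d) (hT : T r s t u n a b c d ≠ 0)
    (hmax : ∀ a' b' c' d', inP n a' b' c' d' → T r s t u n a' b' c' d' ≠ 0 →
      (T r s t u n a' b' c' d').intDegree ≤ (T r s t u n a b c d).intDegree) :
    b = a + c ∧ d = 0 ∧ 0 ≤ a ∧ 0 ≤ c ∧ a + c ≤ n := by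
  obtain ⟨ha, han, hb, hbn, hc, hcn, hd, hdn, h1, h2⟩ := hP
  rw [abs_le] at h1
  have hlt : ∀ {a' b' c' d' k l : ℤ}, inP n a' b' c' d' → HasDeg (T r s t u n a b c d) k →
      HasDeg (T r s t u n a' b' c' d') l → l ≤ k := by
    intro a' b' c' d' k l hP' hk hl
    rw [← hk.2, ← hl.2]
    exact hmax a' b' c' d' hP' hl.1
  have hin : ∀ {a' b' c' d' : ℤ}, 0 ≤ a' → a' ≤ n → 0 ≤ b' → b' ≤ n → 0 ≤ c' → c' ≤ n →
      0 ≤ d' → d' ≤ n → (-c' ≤ a' - b' ∧ a' - b' ≤ c') → c' ≤ a' + b' → inP n a' b' c' d' :=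
    fun h1 h2 h3 h4 h5 h6 h7 h8 h9 h10 => ⟨h1, h2, h3, h4, h5, h6, h7, h8, abs_le.2 h9, h10⟩
  obtain ⟨m, hab, hbc, hac, hm⟩ : ∃ m, m ≤ n + a + b ∧ m ≤ n + b + c ∧ m ≤ n + a + c ∧
      (m = n + a + b ∨ m = n + b + c ∨ m = n + a + c) :=
    ⟨min (n + a + b) (min (n + b + c) (n + a + c)), by omega, by omega, by omega, by omega⟩
  obtain rfl : d = 0 := by
    by_contra hd0
    obtain ⟨m', hm1, hm2, hm'⟩ : ∃ m', m' ≤ 2 * n ∧ m' ≤ n + b + d ∧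
        (m' = 2 * n ∨ m' = n + b + d) :=
      ⟨min (2 * n) (n + b + d), by omega, by omega, by omega⟩
    have hP0 : inP n a b c 0 := by apply hin <;> omega
    have hPd : inP n a b c d := by apply hin <;> omega
    exact (summandDeg_lt_zero hu (by omega) hm1 hm2 hm').not_ge
      (hlt hP0 (hasDeg_T hPd hab hbc hac hm hm1 hm2 hm')
        (hasDeg_T hP0 hab hbc hac hm (by omega) (by omega) (by omega)))
  have hP : inP n a b c 0 := by apply hin <;> omega
  have hdeg := hasDeg_T (r := r) (s := s) (t := t) (u := u) (m' := n + b) hP hab hbc hac hm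
    (by omega) (by omega) (by omega)
  suffices h : b = a + c by omega
  by_contra hne
  rcases hbn.lt_or_eq with hbn | rfl
  · have hP' : inP n a (b + 1) c 0 := by apply hin <;> omega
    by_cases hmid : a ≤ b ∧ c ≤ b
    · exact (summandDeg_lt_succ hs ha hb hc (by omega)).not_ge
        (hlt hP' hdeg (hasDeg_T hP' (by omega) (by omega) (by omega) (by omega)
          (by omega) (by omega) (by omega)))
    rcases le_total c a with hca | hac
    · exact (summandDeg_lt_succ_left hs hb hca (by omega)).not_ge
        (hlt hP' hdeg (hasDeg_T hP' (by omega) (by omega) (by omega) (by omega)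
          (by omega) (by omega) (by omega)))
    · exact (summandDeg_lt_succ_right hs hb hac (by omega)).not_ge
        (hlt hP' hdeg (hasDeg_T hP' (by omega) (by omega) (by omega) (by omega)
          (by omega) (by omega) (by omega)))
  · have hP' : inP b (a - 1) b c 0 := by apply hin <;> omega
    obtain rfl : m = b + a + c := by omega
    exact (summandDeg_lt_pred hr (by omega) (by omega)).not_ge
      (hlt hP' hdeg (hasDeg_T hP' (by omega) (by omega) (by omega) (by omega)
        (by omega) (by omega) (by omega)))
end
end

section
/- Let r = 5, s = −3, t = 5, let u ≤ −3 be an odd integer and let n ≥ 2. Then every summand T_{a,2a,a,0} of maximal v-degree in the state sum has leading coefficient (−1)^{8a + 2n(−11 + u)} = 1; in particular all maximal-degree summands have the same leading coefficient 1, so no cancellation occurs in the top degree. -/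
/-!
Common definitions for formalizing "Colored Jones polynomials without tails"
(Lee--van der Veen).  We work in the field `RatFunc ℚ` of rational functions
in one variable `V` over `ℚ`.
-/

open Polynomial

noncomputable section

namespace CJP

lemma leadC_algebraMap (p : ℚ[X]) :
    leadC (algebraMap ℚ[X] (RatFunc ℚ) p) = p.leadingCoeff := by
  simp [leadC]

lemma leadC_mul (x y : RatFunc ℚ) : leadC (x * y) = leadC x * leadC y := by
  have h := congrArg leadingCoeff (RatFunc.num_denom_mul x y)
  simpa [leadC, (RatFunc.monic_denom _).leadingCoeff] using h

/-- The leading coefficient as a multiplicative map. -/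
def leadCHom : RatFunc ℚ →*₀ ℚ where
  toFun := leadC
  map_zero' := by simp [leadC]
  map_one' := by simp [leadC]
  map_mul' := leadC_mul

lemma leadCHom_algebraMap (p : ℚ[X]) :
    leadCHom (algebraMap ℚ[X] (RatFunc ℚ) p) = p.leadingCoeff :=
  leadC_algebraMap p

lemma leadCHom_neg_one : leadCHom (-1) = -1 := by
  simpa using leadCHom_algebraMap (-1)

lemma leadCHom_V : leadCHom V = 1 := by
  simpa [V] using leadCHom_algebraMap X

lemma V_ne_zero : V ≠ 0 := RatFunc.X_ne_zero

lemma qint_mul (k : ℕ) :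
    V ^ (2 * ((k : ℤ) - 1)) * qint k * (V ^ 4 - 1) = V ^ (4 * k) - 1 := by
  have h : V ^ (2 * ((k : ℤ) - 1)) * qint k = ∑ j ∈ Finset.range k, (V ^ 4) ^ j := by
    rw [qint, Finset.mul_sum, Int.toNat_natCast,
      ← Finset.sum_range_reflect (fun j => (V ^ 4) ^ j)]
    refine Finset.sum_congr rfl fun j hj => ?_
    have hj' := Finset.mem_range.mp hj
    rw [← zpow_add₀ V_ne_zero, ← pow_mul, ← zpow_natCast]
    congr 1
    omega
  rw [h, geom_sum_mul, pow_mul]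

lemma leadCHom_V_pow_sub_one {m : ℕ} (hm : m ≠ 0) : leadCHom (V ^ m - 1) = 1 := by
  have h := leadCHom_algebraMap (X ^ m - C 1)
  rw [(monic_X_pow_sub_C (1 : ℚ) hm).leadingCoeff] at h
  simpa [V] using h

lemma leadCHom_qint {k : ℤ} (hk : 0 < k) : leadCHom (qint k) = 1 := by
  lift k to ℕ using hk.le
  have h := congrArg leadCHom (qint_mul k)
  simpa [leadCHom_V, leadCHom_V_pow_sub_one (show 4 * k ≠ 0 by omega),
    leadCHom_V_pow_sub_one four_ne_zero] using h

lemma leadCHom_qfact {k : ℤ} (hk : 0 ≤ k) : leadCHom (qfact k) = 1 := by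
  rw [qfact, if_neg hk.not_gt, map_prod]
  exact Finset.prod_eq_one fun j _ => leadCHom_qint (by positivity)

lemma leadCHom_qO {k : ℤ} (hk : 0 ≤ k) : leadCHom (qO k) = (-1) ^ k := by
  rw [qO, map_mul, map_zpow₀, leadCHom_neg_one, leadCHom_qint (by omega), mul_one]

lemma leadCHom_qbinom {n k : ℤ} (hk : 0 ≤ k) (hkn : k ≤ n) : leadCHom (qbinom n k) = 1 := by
  simp [qbinom, leadCHom_qfact hk, leadCHom_qfact (hk.trans hkn),
    leadCHom_qfact (sub_nonneg.mpr hkn)]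

lemma qbinom_eq_zero {n k : ℤ} (h : k < 0 ∨ n < k) : qbinom n k = 0 := by
  rcases h with h | h
  · simp [qbinom, qfact, h]
  · have h' : n - k < 0 := by omega
    simp [qbinom, qfact, h']

lemma leadCHom_qtheta {a b c : ℤ} (ha : 0 ≤ -a + b + c) (hb : 0 ≤ a - b + c)
    (hc : 0 ≤ a + b - c) : leadCHom (qtheta a b c) = (-1) ^ ((a + b + c) / 2) := by
  have hs : 0 ≤ (a + b + c) / 2 := by omega
  rw [qtheta, map_mul, leadCHom_qO hs, map_div₀, map_mul, map_mul, leadCHom_qfact hs,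
    leadCHom_qfact (by omega), leadCHom_qfact (by omega), leadCHom_qfact (by omega)]
  simp

lemma leadCHom_qf (a : ℤ) : leadCHom (qf a) = (-1) ^ (a / 2) := by
  simp [qf, leadCHom_neg_one, leadCHom_V]

/-- If the only summand of the `6j`-symbol which can be nonzero is the one at `z`, its
leading coefficient is a sign. -/
lemma leadCHom_qdelta_of_unique {a b c α β γ z : ℤ} (hs : 0 ≤ (a + b + c) / 2)
    (hz : (a + b + c) / 2 ≤ z)
    (ha : (a + β + γ) / 2 ≤ z) (ha' : z - (a + β + γ) / 2 ≤ (-a + b + c) / 2)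
    (hb : (α + b + γ) / 2 ≤ z) (hb' : z - (α + b + γ) / 2 ≤ (a - b + c) / 2)
    (hc : (α + β + c) / 2 ≤ z) (hc' : z - (α + β + c) / 2 ≤ (a + b - c) / 2)
    (huniq : ∀ y, (a + β + γ) / 2 ≤ y → (α + b + γ) / 2 ≤ y →
      y - (α + b + γ) / 2 ≤ (a - b + c) / 2 → y = z) :
    leadCHom (qdelta a b c α β γ) = (-1) ^ z * (-1) ^ ((a + b + c) / 2) := by
  rw [qdelta, finsum_eq_single _ z]
  · rw [map_mul, map_mul, map_mul, map_mul, map_div₀, leadCHom_qO (hs.trans hz),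
      leadCHom_qO hs, leadCHom_qbinom hs hz, leadCHom_qbinom (by omega) ha',
      leadCHom_qbinom (by omega) hb', leadCHom_qbinom (by omega) hc']
    simp [div_eq_mul_inv, ← inv_zpow, inv_neg]
  · intro y hy
    by_cases h₁ : (a + β + γ) / 2 ≤ y
    · have : qbinom ((a - b + c) / 2) (y - (α + b + γ) / 2) = 0 := by
        apply qbinom_eq_zero
        by_contra! h
        exact hy (huniq y h₁ (by omega) h.2)
      simp [this]
    · have : qbinom ((-a + b + c) / 2) (y - (a + β + γ) / 2) = 0 :=
        qbinom_eq_zero (by omega)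
      simp [this]

lemma leadC_T_of_two_mul {r s t u n a : ℤ} (ha : 0 ≤ a) (han : 2 * a ≤ n) :
    leadC (T r s t u n a (2 * a) a 0) = (-1) ^ (a * (r + t)) := by
  change leadCHom _ = _
  have h₁ : leadCHom (qdelta (2*a) (2*(2*a)) (2*a) n n n) =
      (-1) ^ (n + 2 * a) * (-1) ^ ((2*a + 2*(2*a) + 2*a) / 2) :=
    leadCHom_qdelta_of_unique (by omega) (by omega) (by omega) (by omega) (by omega)
      (by omega) (by omega) (by omega) (by omega)
  have h₂ : leadCHom (qdelta (2*(2*a)) n n (2*0) n n) =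
      (-1) ^ (n + 2 * a) * (-1) ^ ((2*(2*a) + n + n) / 2) :=
    leadCHom_qdelta_of_unique (by omega) (by omega) (by omega) (by omega) (by omega)
      (by omega) (by omega) (by omega) (by omega)
  have hne : (-1 : ℚ) ≠ 0 := by norm_num
  have e₁ : (2*a + 2*(2*a) + 2*a) / 2 = 2 * (2 * a) := by omega
  have e₂ : (2*(2*a) + n + n) / 2 = 2 * a + n := by omega
  have e₃ : (2*a + n + n) / 2 = a + n := by omega
  have e₄ : (0 + n + n) / 2 = n := by omega
  have e₅ : 2 * a / 2 = a := by omega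
  have e₆ : 2 * (2 * a) / 2 = 2 * a := by omega
  have sq (m : ℤ) : ((-1 : ℚ) ^ m) ^ 2 = 1 := by
    rw [← zpow_natCast, ← zpow_mul, mul_comm]
    exact (even_two_mul m).neg_one_zpow
  simp only [T, map_mul, map_div₀, map_pow, map_zpow₀, h₁, h₂]
  rw [leadCHom_qO (by omega : 0 ≤ 2 * a), leadCHom_qO (by omega : 0 ≤ 2 * (2 * a)),
    leadCHom_qO (by omega : (0 : ℤ) ≤ 2 * 0),
    leadCHom_qtheta (by omega) (by omega) (by omega),
    leadCHom_qtheta (by omega) (by omega) (by omega),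
    leadCHom_qtheta (by omega) (by omega) (by omega),
    leadCHom_qtheta (by omega) (by omega) (by omega)]
  simp only [leadCHom_qf, e₁, e₂, e₃, e₄, e₅, e₆, mul_zero, EuclideanDomain.zero_div,
    zpow_zero, one_zpow, (even_two_mul _).neg_one_zpow, zpow_add₀ hne, mul_add, zpow_mul]
  have hsq := sq a
  have hn0 : (-1 : ℚ) ^ n ≠ 0 := zpow_ne_zero _ hne
  have ha0 : (-1 : ℚ) ^ a ≠ 0 := zpow_ne_zero _ hne
  field_simp
  simp [hsq]

end CJP

open CJP in
/-- For `r = 5`, `s = -3`, `t = 5`, odd `u ≤ -3` and `n ≥ 2`,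
every summand `T_{a,2a,a,0}` of maximal `v`-degree in the state sum has leading
coefficient `(-1)^(8a + 2n(-11+u)) = 1`; in particular all maximal-degree
summands have the same leading coefficient `1`. -/
theorem maximal_summand_leading_coeff (u n : ℤ) (huodd : Odd u) (hu : u ≤ -3)
    (hn : 2 ≤ n) (a : ℤ) (hP : inP n a (2 * a) a 0)
    (hT : T 5 (-3) 5 u n a (2 * a) a 0 ≠ 0)
    (hmax : ∀ a' b' c' d', inP n a' b' c' d' → T 5 (-3) 5 u n a' b' c' d' ≠ 0 →
      (T 5 (-3) 5 u n a' b' c' d').intDegree ≤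
        (T 5 (-3) 5 u n a (2 * a) a 0).intDegree) :
    leadC (T 5 (-3) 5 u n a (2 * a) a 0) = (-1 : ℚ) ^ (8 * a + 2 * n * (-11 + u)) ∧
    (-1 : ℚ) ^ (8 * a + 2 * n * (-11 + u)) = 1 := by
  have h₁ : Even (8 * a + 2 * n * (-11 + u)) := ⟨4 * a + n * (-11 + u), by ring⟩
  have h₂ : Even (a * (5 + 5)) := ⟨a * 5, by ring⟩
  rw [leadC_T_of_two_mul hP.1 hP.2.2.2.1, h₁.neg_one_zpow, h₂.neg_one_zpow]
  exact ⟨rfl, rfl⟩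
end
end
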